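/- arXiv:1003.2218 — 2 statements merged into one kernel-verified Lean document; each statement's English description precedes it below -/
import Mathlib

section
/- Let Ω be a finite nonempty set, q : 𝒫(Ω) × Ω → ℝ a function such that π ↦ q(π,ω) is continuous on 𝒫(Ω) for each ω ∈ Ω, and C ∈ ℝ a constant such that ∑_{ω∈Ω} π(ω)·q(π,ω) ≤ C for all π ∈ 𝒫(Ω). Then there exists π ∈ 𝒫(Ω) such that q(π,ω) ≤ C for all ω ∈ Ω. -/
open scoped ENNReal BigOperators
open Filter

noncomputable section

variable {Ω : Type*} [Fintype Ω]

/-- `pexp r t = exp(r·t)` for `t ∈ [0,∞]`, with value `∞` when `t = ∞`. -/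
def pexp (r : ℝ) (t : ℝ≥0∞) : ℝ≥0∞ :=
  if t = ∞ then ∞ else ENNReal.ofReal (Real.exp (r * t.toReal))

/-- `nexp r t = exp(−r·t)` for `t ∈ [0,∞]`, with value `0` when `t = ∞`. -/
def nexp (r : ℝ) (t : ℝ≥0∞) : ℝ≥0∞ :=
  if t = ∞ then 0 else ENNReal.ofReal (Real.exp (-(r * t.toReal)))

/-- Expectation `E_π g = ∑_{ω : π ω ≠ 0} π(ω)·g(ω)` in `[0,∞]` (since `0·∞ = 0` in
`ℝ≥0∞`, the terms with `π ω = 0` contribute nothing, so we may sum over all `ω`). -/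
def expect (π : Ω → ℝ) (g : Ω → ℝ≥0∞) : ℝ≥0∞ :=
  ∑ ω, ENNReal.ofReal (π ω) * g ω

/-- The superprediction set `Σ_Λ` of a game `(Ω, Λ)`. -/
def superpred (Λ : Set (Ω → ℝ≥0∞)) : Set (Ω → ℝ≥0∞) :=
  {g | ∃ γ ∈ Λ, ∀ ω, γ ω ≤ g ω}

/-- `−(1/η)·ln x`, with value `∞` at `x = 0`. -/
def negLogDiv (η : ℝ) (x : ℝ≥0∞) : ℝ≥0∞ :=
  if x = 0 then ∞ else ENNReal.ofReal (-(1 / η) * Real.log x.toReal)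

/-- The exp-convex hull `Σ_Λ^η` of the superprediction set. -/
def expHull (η : ℝ) (Λ : Set (Ω → ℝ≥0∞)) : Set (Ω → ℝ≥0∞) :=
  {g | ∃ k : ℕ, 0 < k ∧ ∃ (gs : Fin k → Ω → ℝ≥0∞) (ρ : Fin k → ℝ),
    (∀ i, gs i ∈ superpred Λ) ∧ (∀ i, 0 ≤ ρ i) ∧ (∑ i, ρ i = 1) ∧
    ∀ ω, g ω = negLogDiv η (∑ i, ENNReal.ofReal (ρ i) * nexp η (gs i ω))}

/-- The set of minimal elements of `X`. -/
def minSet (X : Set (Ω → ℝ≥0∞)) : Set (Ω → ℝ≥0∞) :=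
  {g | g ∈ X ∧ ∀ g' ∈ X, (∀ ω, g' ω ≤ g ω) → g' = g}

/-- A finite set `B` is dominant for the rankings `r i` if every point is ranked weakly below
all of `B` by at least one of them. -/
def Dominant {Z I α : Type*} [LinearOrder α] (r : I → Z → α) (B : Finset Z) : Prop :=
  ∀ z, ∃ i, ∀ b ∈ B, r i z ≤ r i b

lemma Dominant.mono {Z I α : Type*} [LinearOrder α] {r : I → Z → α} {B D : Finset Z}
    (hB : Dominant r B) (h : D ⊆ B) : Dominant r D := fun z =>
  (hB z).imp fun _ hi b hb => hi b (h hb)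

open Classical in
/-- A set of `|I|` points whose colours miss some colour has an even number of points whose
removal leaves every colour except `i₀`. -/
lemma even_card_erase_image_eq {Z I : Type*} [Fintype I] (c : Z → I) (i₀ : I)
    (B : Finset Z) (hB : B.card = Fintype.card I) (hc : B.image c ≠ Finset.univ) :
    Even (B.filter fun b => (B.erase b).image c = Finset.univ.erase i₀).card := by
  have inj : ∀ b ∈ B, (B.erase b).image c = Finset.univ.erase i₀ →
      Set.InjOn c (B.erase b : Finset Z) := by
    intro b hb h
    rw [← Finset.card_image_iff, h, Finset.card_erase_of_mem hb,
      Finset.card_erase_of_mem (Finset.mem_univ _), hB, Finset.card_univ]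
  rcases (B.filter fun b => (B.erase b).image c = Finset.univ.erase i₀).eq_empty_or_nonempty
    with h | ⟨b, hb⟩
  · simp [h]
  obtain ⟨hbB, hbc⟩ := Finset.mem_filter.1 hb
  have hins : B.image c = insert (c b) (Finset.univ.erase i₀) := by
    rw [← hbc, ← Finset.image_insert, Finset.insert_erase hbB]
  have hne : c b ≠ i₀ := by
    intro h
    apply hc
    rw [hins, h, Finset.insert_erase (Finset.mem_univ _)]
  have : c b ∈ (B.erase b).image c := by rw [hbc]; simp [hne]
  obtain ⟨b', hb', hcb⟩ := Finset.mem_image.1 this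
  obtain ⟨hb'b, hb'B⟩ := Finset.mem_erase.1 hb'
  have hb'c : (B.erase b').image c = Finset.univ.erase i₀ := by
    rw [← hbc]
    ext i
    simp only [Finset.mem_image, Finset.mem_erase]
    constructor
    · rintro ⟨a, ⟨ha, haB⟩, rfl⟩
      by_cases hab : a = b
      · exact ⟨b', ⟨hb'b, hb'B⟩, by rw [hcb, hab]⟩
      · exact ⟨a, ⟨hab, haB⟩, rfl⟩
    · rintro ⟨a, ⟨ha, haB⟩, rfl⟩
      by_cases hab : a = b'
      · exact ⟨b, ⟨hb'b.symm, hbB⟩, by rw [← hcb, hab]⟩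
      · exact ⟨a, ⟨hab, haB⟩, rfl⟩
  have : (B.filter fun b => (B.erase b).image c = Finset.univ.erase i₀) = {b, b'} := by
    ext a
    simp only [Finset.mem_filter, Finset.mem_insert, Finset.mem_singleton]
    constructor
    · rintro ⟨haB, hac⟩
      by_contra! hcon
      refine hb'b (inj a haB hac ?_ ?_ hcb)
      · simp [hb'B, hcon.2.symm]
      · simp [hbB, hcon.1.symm]
    · rintro (rfl | rfl)
      · exact ⟨hbB, hbc⟩
      · exact ⟨hb'B, hb'c⟩
  rw [this, Finset.card_pair hb'b.symm]
  exact even_two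

open Classical in
/-- A dominant set of `|I| - 1` points has exactly two dominant extensions by one point, as soon
as no index `k` has the other indices' minima cut out an empty region. -/
lemma Dominant.card_extensions {Z I α : Type*} [Fintype Z] [Fintype I] [LinearOrder α]
    {r : I → Z → α} (hr : ∀ i, Function.Injective (r i)) {D : Finset Z} (hD : Dominant r D)
    (hcard : D.card + 1 = Fintype.card I) (hne : D.Nonempty)
    (hreg : ∀ k, ∃ z, ∀ l ≠ k, ∃ d ∈ D, r l d < r l z) :
    (Finset.univ.filter fun z => z ∉ D ∧ Dominant r (insert z D)).card = 2 := by
  choose m hmD hm using fun i => D.exists_min_image (r i) hne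
  have hmsurj : ∀ d ∈ D, ∃ i, m i = d := fun d hd => by
    obtain ⟨i, hi⟩ := hD d
    exact ⟨i, hr i (le_antisymm (hm i d hd) (hi _ (hmD i)))⟩
  have hinj : ∀ k, D ⊆ (Finset.univ.erase k).image m →
      Set.InjOn m (Finset.univ.erase k : Finset I) := by
    intro k hk
    rw [← Finset.card_image_iff]
    apply le_antisymm Finset.card_image_le
    calc _ = D.card := by
          rw [Finset.card_erase_of_mem (Finset.mem_univ _), Finset.card_univ]; omega
      _ ≤ _ := Finset.card_le_card hk
  obtain ⟨i, -, j, -, hij, hmij⟩ := Finset.exists_ne_map_eq_of_card_lt_of_maps_to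
    (s := (Finset.univ : Finset I)) (t := D) (f := m)
    (by rw [Finset.card_univ]; omega) (fun i _ => hmD i)
  have hsurj' : ∀ k, k = i ∨ k = j → ∀ d ∈ D, ∃ l ≠ k, m l = d := by
    intro k hk d hd
    obtain ⟨l, rfl⟩ := hmsurj d hd
    by_cases hl : l = k
    · subst hl
      rcases hk with rfl | rfl
      · exact ⟨j, hij.symm, hmij.symm⟩
      · exact ⟨i, hij, hmij⟩
    · exact ⟨l, hl, rfl⟩
  have hex : ∀ k, ∃ x, (∀ l ≠ k, r l (m l) < r l x) ∧
      ∀ y, (∀ l ≠ k, r l (m l) < r l y) → r k y ≤ r k x := by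
    intro k
    obtain ⟨z, hz⟩ := hreg k
    obtain ⟨x, hx, hxmax⟩ := Finset.exists_max_image
      (Finset.univ.filter fun x => ∀ l ≠ k, r l (m l) < r l x) (r k)
      ⟨z, by
        simp only [Finset.mem_filter, Finset.mem_univ, true_and]
        intro l hl
        obtain ⟨d, hd, hdz⟩ := hz l hl
        exact (hm l d hd).trans_lt hdz⟩
    exact ⟨x, by simpa using hx, fun y hy => hxmax y (by simpa using hy)⟩
  choose x hx hxmax using hex
  have hnot : ∀ z, ¬ ∀ l, r l (m l) < r l z := by
    intro z h
    obtain ⟨l, hl⟩ := hD z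
    exact absurd (hl _ (hmD l)) (not_le.2 (h l))
  have hxne : x i ≠ x j := by
    intro h
    apply hnot (x i)
    intro l
    by_cases hl : l = i
    · rw [h]; exact hx j l (by rw [hl]; exact hij)
    · exact hx i l hl
  have hmem : ∀ k, k = i ∨ k = j → x k ∉ D ∧ Dominant r (insert (x k) D) := by
    intro k hk
    constructor
    · intro hxD
      obtain ⟨l, hl, hml⟩ := hsurj' k hk _ hxD
      have := hx k l hl
      rw [hml] at this
      exact lt_irrefl _ this
    · intro y
      by_cases hy : ∀ l ≠ k, r l (m l) < r l y
      · refine ⟨k, fun b hb => ?_⟩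
        rcases Finset.mem_insert.1 hb with rfl | hb
        · exact hxmax k y hy
        · refine le_trans ?_ (hm k b hb)
          by_contra! h
          refine hnot y fun l => ?_
          by_cases hl : l = k
          · rw [hl]; exact h
          · exact hy l hl
      · push Not at hy
        obtain ⟨l, hl, hyl⟩ := hy
        refine ⟨l, fun b hb => ?_⟩
        rcases Finset.mem_insert.1 hb with rfl | hb
        · exact hyl.trans (hx k l hl).le
        · exact hyl.trans (hm l b hb)
  have heq : (Finset.univ.filter fun z => z ∉ D ∧ Dominant r (insert z D)) = {x i, x j} := by
    ext z
    simp only [Finset.mem_filter, Finset.mem_univ, true_and, Finset.mem_insert,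
      Finset.mem_singleton]
    constructor
    · rintro ⟨hzD, hz⟩
      obtain ⟨k, hk⟩ := not_forall.1 (hnot z)
      have hcov : ∀ d ∈ D, ∃ l, m l = d ∧ r l (m l) < r l z := by
        intro d hd
        obtain ⟨l, hl⟩ := hz d
        have hml : m l = d :=
          hr l (le_antisymm (hm l d hd) (hl _ (Finset.mem_insert_of_mem (hmD l))))
        refine ⟨l, hml, lt_of_le_of_ne ?_ ?_⟩
        · rw [hml]; exact hl z (Finset.mem_insert_self _ _)
        · intro h
          exact hzD (hr l h ▸ hmD l)
      have hkinj := hinj k fun d hd => by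
        obtain ⟨l, rfl, hl⟩ := hcov d hd
        exact Finset.mem_image_of_mem m (by
          simp only [Finset.mem_erase, Finset.mem_univ, and_true]
          rintro rfl
          exact hk hl)
      have hzk : ∀ l ≠ k, r l (m l) < r l z := by
        intro l hl
        obtain ⟨l', hl', hlt⟩ := hcov (m l) (hmD l)
        have : l' = l := hkinj (by
          simp only [Finset.coe_erase, Finset.coe_univ, Set.mem_sdiff, Set.mem_univ, true_and,
            Set.mem_singleton_iff]
          rintro rfl
          exact hk hlt) (by simpa using hl) hl'
        exact this ▸ hlt
      have hkij : k = i ∨ k = j := by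
        by_contra! h
        exact hij (hkinj (by simpa using h.1.symm) (by simpa using h.2.symm) hmij)
      have hzx : z = x k := by
        refine hr k (le_antisymm (hxmax k z hzk) ?_)
        obtain ⟨l, hl⟩ := hz (x k)
        by_cases hlk : l = k
        · exact hlk ▸ hl z (Finset.mem_insert_self _ _)
        · exact absurd (hl _ (Finset.mem_insert_of_mem (hmD l))) (not_le.2 (hx k l hlk))
      rcases hkij with h | h
      · exact Or.inl (h ▸ hzx)
      · exact Or.inr (h ▸ hzx)
    · rintro (rfl | rfl)
      · exact hmem i (Or.inl rfl)
      · exact hmem j (Or.inr rfl)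
  rw [heq, Finset.card_pair hxne]

open Classical in
/-- **Scarf's lemma**: with one slack point `e i` per ranking, lowest for `r i` and highest for
the other rankings, every colouring giving `e i` the colour `i` has a dominant set on which each
colour occurs exactly once. -/
theorem exists_dominant_image_eq_univ {Z I α : Type*} [Fintype Z] [Fintype I] [Nonempty I]
    [LinearOrder α] (r : I → Z → α) (hr : ∀ i, Function.Injective (r i)) (e : I → Z)
    (hlow : ∀ i z, r i (e i) ≤ r i z)
    (hhigh : ∀ i j z, i ≠ j → z ∉ Set.range e → r i z < r i (e j))
    (hne : ∃ z, z ∉ Set.range e) (c : Z → I) (hc : ∀ i, c (e i) = i) :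
    ∃ B : Finset Z, Dominant r B ∧ B.card = Fintype.card I ∧ B.image c = Finset.univ := by
  by_contra! hcon
  obtain ⟨i₀⟩ := ‹Nonempty I›
  have hlow' : ∀ i z, z ≠ e i → r i (e i) < r i z := fun i z h =>
    lt_of_le_of_ne (hlow i z) fun h' => h (hr i h').symm
  have hinj : Function.Injective e := Function.LeftInverse.injective hc
  set doors : Finset (Finset Z) := Finset.univ.filter fun D =>
    D.image c = Finset.univ.erase i₀ ∧ D.card + 1 = Fintype.card I with hdoors
  set rooms : Finset (Finset Z) := Finset.univ.filter fun B =>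
    Dominant r B ∧ B.card = Fintype.card I with hrooms
  set s : Finset Z → Finset Z := fun D =>
    Finset.univ.filter fun z => z ∉ D ∧ Dominant r (insert z D) with hs
  set t : Finset Z → Finset Z := fun B =>
    B.filter fun b => (B.erase b).image c = Finset.univ.erase i₀ with ht
  have hcount : ∑ D ∈ doors, (s D).card = ∑ B ∈ rooms, (t B).card := by
    rw [← Finset.card_sigma, ← Finset.card_sigma]
    refine Finset.card_bij' (fun p _ => ⟨insert p.2 p.1, p.2⟩) (fun p _ => ⟨p.1.erase p.2, p.2⟩)
      ?_ ?_ ?_ ?_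
    · rintro ⟨D, z⟩ h
      simp only [hdoors, hs, hrooms, ht, Finset.mem_sigma, Finset.mem_filter, Finset.mem_univ,
        true_and] at h ⊢
      obtain ⟨⟨h1, h2⟩, h3, h4⟩ := h
      refine ⟨⟨h4, ?_⟩, Finset.mem_insert_self _ _, ?_⟩
      · rw [Finset.card_insert_of_notMem h3, h2]
      · rw [Finset.erase_insert h3, h1]
    · rintro ⟨B, z⟩ h
      simp only [hdoors, hs, hrooms, ht, Finset.mem_sigma, Finset.mem_filter, Finset.mem_univ,
        true_and] at h ⊢
      obtain ⟨⟨h1, h2⟩, h3, h4⟩ := h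
      refine ⟨⟨h4, ?_⟩, Finset.notMem_erase _ _, ?_⟩
      · rw [Finset.card_erase_add_one h3, h2]
      · rwa [Finset.insert_erase h3]
    · rintro ⟨D, z⟩ h
      simp only [hs, Finset.mem_sigma, Finset.mem_filter, Finset.mem_univ, true_and] at h
      simp [Finset.erase_insert h.2.1]
    · rintro ⟨B, z⟩ h
      simp only [ht, Finset.mem_sigma, Finset.mem_filter] at h
      simp [Finset.insert_erase h.2.1]
  have heven : Even (∑ B ∈ rooms, (t B).card) := by
    refine Finset.even_sum _ fun B hB => ?_
    simp only [hrooms, Finset.mem_filter, Finset.mem_univ, true_and] at hB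
    exact even_card_erase_image_eq c i₀ B hB.2 (hcon B hB.1 hB.2)
  set D₀ : Finset Z := (Finset.univ.erase i₀).image e with hD₀
  have hmemD₀ : ∀ z, z ∈ D₀ ↔ ∃ j, j ≠ i₀ ∧ e j = z := by simp [hD₀]
  have hD₀card : (s D₀).card = 1 := by
    obtain ⟨x₀, hx₀⟩ := hne
    obtain ⟨x, hx, hxmax⟩ := Finset.exists_max_image
      (Finset.univ.filter fun x => x ∉ Set.range e) (r i₀) ⟨x₀, by simpa using hx₀⟩
    replace hx : x ∉ Set.range e := by simpa using hx
    replace hxmax : ∀ y, y ∉ Set.range e → r i₀ y ≤ r i₀ x := fun y hy =>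
      hxmax y (by simpa using hy)
    rw [Finset.card_eq_one]
    refine ⟨x, ?_⟩
    ext z
    simp only [hs, Finset.mem_filter, Finset.mem_univ, true_and, Finset.mem_singleton]
    constructor
    · rintro ⟨hzD, hz⟩
      have key : ∀ y, y ∉ Set.range e → r i₀ y ≤ r i₀ z := by
        intro y hy
        obtain ⟨i, hi⟩ := hz y
        by_cases h : i = i₀
        · exact h ▸ hi z (Finset.mem_insert_self _ _)
        · exact absurd (hi (e i) (Finset.mem_insert_of_mem ((hmemD₀ _).2 ⟨i, h, rfl⟩)))
            (not_le.2 (hlow' i y fun h => hy ⟨i, h.symm⟩))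
      have hzr : z ∉ Set.range e := by
        rintro ⟨j, rfl⟩
        by_cases h : j = i₀
        · subst h
          exact absurd (key x hx) (not_le.2 (hlow' j x fun h => hx ⟨j, h.symm⟩))
        · exact hzD ((hmemD₀ _).2 ⟨j, h, rfl⟩)
      exact hr i₀ (le_antisymm (hxmax z hzr) (key x hx))
    · rintro rfl
      refine ⟨fun h => ?_, fun y => ?_⟩
      · obtain ⟨j, -, hj⟩ := (hmemD₀ _).1 h
        exact hx ⟨j, hj⟩
      · by_cases hy : y ∈ Set.range e
        · obtain ⟨j, rfl⟩ := hy
          exact ⟨j, fun b _ => hlow j b⟩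
        · refine ⟨i₀, fun b hb => ?_⟩
          rcases Finset.mem_insert.1 hb with rfl | hb
          · exact hxmax y hy
          · obtain ⟨j, hj, rfl⟩ := (hmemD₀ _).1 hb
            exact (hhigh i₀ j y hj.symm hy).le
  have hD₀door : D₀ ∈ doors := by
    simp only [hdoors, Finset.mem_filter, Finset.mem_univ, true_and]
    constructor
    · rw [hD₀, Finset.image_image]
      have : c ∘ e = id := funext hc
      rw [this, Finset.image_id]
    · rw [hD₀, Finset.card_image_of_injective _ hinj,
        Finset.card_erase_add_one (Finset.mem_univ _), Finset.card_univ]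
  have hother : ∀ D ∈ doors, D ≠ D₀ → Even (s D).card := by
    intro D hD hDD
    simp only [hdoors, Finset.mem_filter, Finset.mem_univ, true_and] at hD
    obtain ⟨hDc, hDcard⟩ := hD
    by_cases hdom : Dominant r D
    swap
    · have : s D = ∅ := by
        ext z
        simp only [hs, Finset.mem_filter, Finset.mem_univ, true_and, Finset.notMem_empty,
          iff_false, not_and]
        exact fun _ h => hdom (h.mono (Finset.subset_insert _ _))
      simp [this]
    have hx : ∃ x ∈ D, x ∉ Set.range e := by
      by_contra! h
      apply hDD
      ext z
      rw [hmemD₀]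
      constructor
      · intro hz
        obtain ⟨j, rfl⟩ := h z hz
        have : c (e j) ∈ D.image c := Finset.mem_image_of_mem c hz
        rw [hDc, hc] at this
        exact ⟨j, Finset.ne_of_mem_erase this, rfl⟩
      · rintro ⟨j, hj, rfl⟩
        have : j ∈ D.image c := by rw [hDc]; simp [hj]
        obtain ⟨d, hd, hdj⟩ := Finset.mem_image.1 this
        obtain ⟨j', rfl⟩ := h d hd
        rw [hc] at hdj
        exact hdj ▸ hd
    obtain ⟨x, hxD, hx⟩ := hx
    have := hdom.card_extensions hr hDcard ⟨x, hxD⟩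
      fun k => ⟨e k, fun l hl => ⟨x, hxD, hhigh l k x hl hx⟩⟩
    rw [show (s D).card = 2 from this]
    exact even_two
  rw [← hcount, ← Finset.add_sum_erase _ _ hD₀door, hD₀card] at heven
  have : Even (∑ D ∈ doors.erase D₀, (s D).card) := Finset.even_sum _ fun D hD =>
    hother D (Finset.mem_of_mem_erase hD) (Finset.ne_of_mem_erase hD)
  exact Nat.not_even_one ((Nat.even_add.1 heven).2 this)

open Classical in
/-- **Scarf's lemma on a grid**: any colouring of the points of `ℕ^I` with coordinate sum `N`
has a cluster of points showing every colour in `C` and lying close to the face spanned by `C`. -/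
theorem exists_grid_cluster {I : Type*} [Fintype I] [Nonempty I] (N : ℕ) (c : (I → ℕ) → I) :
    ∃ (A : Finset (I → ℕ)) (C : Finset I), A.Nonempty ∧ (∀ a ∈ A, ∑ i, a i = N) ∧
      (∀ i ∈ C, ∃ a ∈ A, c a = i) ∧
      (∀ a ∈ A, ∀ b ∈ A, ∀ i, a i ≤ b i + Fintype.card I) ∧
      ∀ a ∈ A, ∀ i ∉ C, a i ≤ Fintype.card I := by
  let X : Type _ := {x : I → ℕ // x ∈ Finset.piAntidiag Finset.univ N}
  have : Fintype X := inferInstanceAs (Fintype {x // x ∈ Finset.piAntidiag Finset.univ N})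
  have hX : ∀ x : X, ∑ i, x.1 i = N := fun x => (Finset.mem_piAntidiag.1 x.2).1
  let h : I → X ⊕ I → ℕ := fun i =>
    Sum.elim (fun x => x.1 i + 1) fun j => if i = j then 0 else N + 2
  let idx := Fintype.equivFin (X ⊕ I)
  let r : I → X ⊕ I → ℕ ×ₗ Fin (Fintype.card (X ⊕ I)) := fun i z => toLex (h i z, idx z)
  have hr : ∀ i, Function.Injective (r i) := fun i z z' hz =>
    idx.injective (congrArg (fun p => (ofLex p).2) hz)
  have hle : ∀ i z z', r i z ≤ r i z' → h i z ≤ h i z' := fun i z z' hz => by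
    rcases Prod.Lex.toLex_le_toLex.1 hz with hz | hz
    · exact hz.le
    · exact hz.1.le
  have hlt : ∀ i z z', h i z < h i z' → r i z < r i z' := fun i z z' hz =>
    Prod.Lex.toLex_lt_toLex.2 (Or.inl hz)
  have hxle : ∀ (x : X) i, x.1 i ≤ N := fun x i => by
    calc x.1 i ≤ ∑ j, x.1 j :=
          Finset.single_le_sum (fun _ _ => Nat.zero_le _) (Finset.mem_univ i)
      _ = N := hX x
  obtain ⟨i₁⟩ := ‹Nonempty I›
  have hsingle : ∀ (y : I → ℕ), ∑ i, y i = N → y ∈ Finset.piAntidiag Finset.univ N := fun y hy =>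
    Finset.mem_piAntidiag.2 ⟨hy, fun _ _ => Finset.mem_univ _⟩
  let x₀ : X := ⟨Pi.single i₁ N, hsingle _ (by simp)⟩
  have : Nonempty I := ⟨i₁⟩
  obtain ⟨B, hB, -, hBc⟩ := exists_dominant_image_eq_univ r hr Sum.inr
    (fun i z => by
      by_cases hz : z = Sum.inr i
      · rw [hz]
      · refine (hlt _ _ _ ?_).le
        rcases z with x | j
        · simp [h]
        · have : i ≠ j := fun hij => hz (by rw [hij])
          simp [h, this])
    (fun i j z hij hz => by
      rcases z with x | k
      · refine hlt _ _ _ ?_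
        have := hxle x i
        simp only [h, Sum.elim_inl, Sum.elim_inr, if_neg hij]
        omega
      · exact absurd ⟨k, rfl⟩ hz)
    ⟨Sum.inl x₀, by simp⟩ (Sum.elim (fun x => c x.1) id) (fun i => rfl)
  let A : Finset (I → ℕ) :=
    (Finset.univ.filter fun x : X => Sum.inl x ∈ B).image Subtype.val
  let C : Finset I := Finset.univ.filter fun i => Sum.inr i ∉ B
  have hAsum : ∀ a ∈ A, ∑ i, a i = N := by
    intro a ha
    obtain ⟨x, -, rfl⟩ := Finset.mem_image.1 ha
    exact hX x
  have hdom : ∀ y : I → ℕ, ∑ i, y i = N → ∃ i ∈ C, ∀ a ∈ A, y i ≤ a i := by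
    intro y hy
    obtain ⟨i, hi⟩ := hB (Sum.inl ⟨y, hsingle y hy⟩)
    refine ⟨i, ?_, fun a ha => ?_⟩
    · simp only [C, Finset.mem_filter, Finset.mem_univ, true_and]
      intro hiB
      have := hle _ _ _ (hi _ hiB)
      simp [h] at this
    · obtain ⟨x, hx, rfl⟩ := Finset.mem_image.1 ha
      have := hle _ _ _ (hi _ (Finset.mem_filter.1 hx).2)
      simpa [h] using this
  have hcol : ∀ i ∈ C, ∃ a ∈ A, c a = i := by
    intro i hi
    have : i ∈ B.image (Sum.elim (fun x : X => c x.1) id) := by rw [hBc]; simp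
    obtain ⟨z, hz, hzi⟩ := Finset.mem_image.1 this
    rcases z with x | j
    · exact ⟨x.1, Finset.mem_image_of_mem _ (by simpa using hz), hzi⟩
    · have hji : j = i := hzi
      exact absurd hz (hji ▸ (Finset.mem_filter.1 hi).2)
  obtain ⟨i₂, hi₂, -⟩ := hdom x₀.1 (hX x₀)
  have hA : A.Nonempty := (hcol i₂ hi₂).imp fun _ ha => ha.1
  choose m hmA hm using fun i => A.exists_min_image (fun a => a i) hA
  have hsum : N < ∑ i ∈ C, (m i i + 1) := by
    by_contra! hN
    let y₀ : I → ℕ := fun i => if i ∈ C then m i i + 1 else 0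
    have hy₀ : ∑ i, y₀ i = ∑ i ∈ C, (m i i + 1) := by simp [y₀]
    obtain ⟨i, hi, hia⟩ := hdom (y₀ + Pi.single i₂ (N - ∑ i ∈ C, (m i i + 1))) (by
      simp only [Pi.add_apply]
      rw [Finset.sum_add_distrib, hy₀, Finset.sum_pi_single']
      simp only [Finset.mem_univ, if_true]
      omega)
    have := hia _ (hmA i)
    simp only [Pi.add_apply, y₀, if_pos hi] at this
    omega
  have hCcard : C.card ≤ Fintype.card I := Finset.card_le_univ C
  rw [Finset.sum_add_distrib, Finset.sum_const, smul_eq_mul, mul_one] at hsum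
  have hCle : ∀ a ∈ A, ∀ s : Finset I, ∑ i ∈ s, m i i ≤ ∑ i ∈ s, a i := fun a ha s =>
    Finset.sum_le_sum fun i _ => hm i a ha
  have hout : ∀ a ∈ A, ∀ i ∉ C, a i ≤ Fintype.card I := by
    intro a ha i hi
    have h1 := hCle a ha C
    have h2 : ∑ j ∈ insert i C, a j ≤ ∑ j, a j :=
      Finset.sum_le_sum_of_subset (Finset.subset_univ _)
    rw [Finset.sum_insert hi, hAsum a ha] at h2
    omega
  refine ⟨A, C, hA, hAsum, hcol, fun a ha b hb i => ?_, hout⟩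
  by_cases hi : i ∈ C
  · have h1 := hCle a ha (C.erase i)
    have h2 : ∑ j ∈ C, a j ≤ ∑ j, a j := Finset.sum_le_sum_of_subset (Finset.subset_univ _)
    rw [← Finset.add_sum_erase _ _ hi, hAsum a ha] at h2
    rw [← Finset.add_sum_erase _ _ hi] at hsum
    have h3 := hm i b hb
    omega
  · exact (hout a ha i hi).trans (Nat.le_add_left _ _)

/-- Any colouring of the standard simplex has, at each scale, a point that for every `i` is close
either to a point of colour `i` or to the facet on which the `i`-th coordinate vanishes. -/
theorem exists_mem_stdSimplex_near_colours {I : Type*} [Fintype I] [Nonempty I] (N : ℕ)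
    (hN : 0 < N) (c : (I → ℝ) → I) :
    ∃ p ∈ stdSimplex ℝ I, ∀ i,
      (∃ p' ∈ stdSimplex ℝ I, c p' = i ∧ dist p' p ≤ (Fintype.card I : ℝ) / N) ∨
        p i ≤ (Fintype.card I : ℝ) / N := by
  have hN' : (0 : ℝ) < N := Nat.cast_pos.2 hN
  let f : (I → ℕ) → I → ℝ := fun a i => (a i : ℝ) / N
  obtain ⟨A, C, ⟨a, ha⟩, hsum, hcol, hclose, hout⟩ := exists_grid_cluster N fun x => c (f x)
  have hf : ∀ b ∈ A, f b ∈ stdSimplex ℝ I := by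
    intro b hb
    refine ⟨fun i => by positivity, ?_⟩
    simp only [f]
    rw [← Finset.sum_div, ← Nat.cast_sum, hsum b hb, div_self hN'.ne']
  have hle : ∀ b ∈ A, ∀ b' ∈ A, ∀ i, f b i - f b' i ≤ (Fintype.card I : ℝ) / N := by
    intro b hb b' hb' i
    simp only [f]
    rw [← sub_div]
    have : (b i : ℝ) ≤ b' i + Fintype.card I := by exact_mod_cast hclose b hb b' hb' i
    gcongr
    linarith
  refine ⟨f a, hf a ha, fun i => ?_⟩
  by_cases hi : i ∈ C
  · obtain ⟨b, hb, hbc⟩ := hcol i hi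
    refine Or.inl ⟨f b, hf b hb, hbc, (dist_pi_le_iff (by positivity)).2 fun j => ?_⟩
    rw [Real.dist_eq, abs_le]
    constructor
    · linarith [hle a ha b hb j]
    · exact hle b hb a ha j
  · right
    simp only [f]
    gcongr
    exact_mod_cast hout a ha i hi

/-- A form of the **Knaster–Kuratowski–Mazurkiewicz lemma**: if the continuous functions `F i` are
such that at every point of the simplex some `F i` is nonpositive, and `F i` is nonpositive where
the `i`-th coordinate vanishes, then all `F i` are nonpositive at a common point. -/
theorem exists_mem_stdSimplex_forall_nonpos {I : Type*} [Fintype I] [Nonempty I]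
    (F : I → (I → ℝ) → ℝ) (hF : ∀ i, ContinuousOn (F i) (stdSimplex ℝ I))
    (hex : ∀ p ∈ stdSimplex ℝ I, ∃ i, F i p ≤ 0)
    (hzero : ∀ p ∈ stdSimplex ℝ I, ∀ i, p i = 0 → F i p ≤ 0) :
    ∃ p ∈ stdSimplex ℝ I, ∀ i, F i p ≤ 0 := by
  classical
  have hcol : ∀ p : I → ℝ, ∃ i, p ∈ stdSimplex ℝ I → F i p ≤ 0 := fun p => by
    by_cases hp : p ∈ stdSimplex ℝ I
    · exact (hex p hp).imp fun _ h _ => h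
    · exact ⟨Classical.arbitrary I, fun h => absurd h hp⟩
  choose c hc using hcol
  choose p hp hpc using fun n : ℕ =>
    exists_mem_stdSimplex_near_colours (n + 1) n.succ_pos c
  let U : Ultrafilter ℕ := Filter.hyperfilter ℕ
  have hU : (U : Filter ℕ) ≤ Filter.atTop := Nat.hyperfilter_le_atTop
  obtain ⟨x, hx, hpx⟩ := (isCompact_stdSimplex ℝ I).ultrafilter_le_nhds (U.map p)
    (Filter.le_principal_iff.2 (Filter.mem_map.2 (Filter.Eventually.of_forall hp)))
  replace hpx : Filter.Tendsto p U (nhds x) := hpx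
  have hε : Filter.Tendsto (fun n : ℕ => (Fintype.card I : ℝ) / ((n + 1 : ℕ) : ℝ)) U (nhds 0) :=
    ((tendsto_const_div_atTop_nhds_zero_nat (Fintype.card I : ℝ)).comp
      (Filter.tendsto_add_atTop_nat 1)).mono_left hU
  refine ⟨x, hx, fun i => ?_⟩
  rcases Ultrafilter.eventually_or.1 (Filter.Eventually.of_forall (f := (U : Filter ℕ))
    fun n => hpc n i) with h | h
  · have : ∀ n, ∃ p', (∃ p' ∈ stdSimplex ℝ I, c p' = i ∧
        dist p' (p n) ≤ (Fintype.card I : ℝ) / ((n + 1 : ℕ) : ℝ)) →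
        p' ∈ stdSimplex ℝ I ∧ c p' = i ∧
          dist p' (p n) ≤ (Fintype.card I : ℝ) / ((n + 1 : ℕ) : ℝ) := fun n => by
      by_cases h : ∃ p' ∈ stdSimplex ℝ I, c p' = i ∧
        dist p' (p n) ≤ (Fintype.card I : ℝ) / ((n + 1 : ℕ) : ℝ)
      · exact h.imp fun _ h' _ => h'
      · exact ⟨0, fun h' => absurd h' h⟩
    choose p' hp' using this
    have hdist : Filter.Tendsto (fun n => dist (p n) (p' n)) U (nhds 0) :=
      tendsto_of_tendsto_of_tendsto_of_le_of_le' tendsto_const_nhds hε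
        (Filter.Eventually.of_forall fun _ => dist_nonneg)
        (h.mono fun n hn => by rw [dist_comm]; exact (hp' n hn).2.2)
    have hp'x : Filter.Tendsto p' U (nhdsWithin x (stdSimplex ℝ I)) :=
      tendsto_nhdsWithin_iff.2 ⟨(tendsto_iff_of_dist hdist).1 hpx, h.mono fun n hn => (hp' n hn).1⟩
    refine le_of_tendsto ((hF i x hx).tendsto.comp hp'x) (h.mono fun n hn => ?_)
    obtain ⟨h1, h2, -⟩ := hp' n hn
    exact h2 ▸ hc (p' n) h1
  · refine hzero x hx i (le_antisymm ?_ (hx.1 i))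
    exact le_of_tendsto_of_tendsto ((continuous_apply i).continuousAt.tendsto.comp hpx) hε h

/-- Lemma 4 of the paper (Levin's property / Ky Fan minimax argument). -/
theorem levin_property
    {Ω : Type*} [Fintype Ω] [Nonempty Ω]
    (q : (Ω → ℝ) → Ω → ℝ) (C : ℝ)
    (hcont : ∀ ω : Ω, ContinuousOn (fun π => q π ω) (stdSimplex ℝ Ω))
    (hsum : ∀ π ∈ stdSimplex ℝ Ω, ∑ ω : Ω, π ω * q π ω ≤ C) :
    ∃ π ∈ stdSimplex ℝ Ω, ∀ ω : Ω, q π ω ≤ C := by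
  let g : Ω → (Ω → ℝ) → ℝ := fun ω π => max (q π ω - C) 0
  have hg0 : ∀ ω π, 0 ≤ g ω π := fun ω π => le_max_right _ _
  have hg : ∀ ω, ContinuousOn (g ω) (stdSimplex ℝ Ω) := fun ω =>
    ((hcont ω).sub continuousOn_const).sup continuousOn_const
  have htotal : ∀ π ∈ stdSimplex ℝ Ω, ∑ ω, (π ω * ∑ j, g j π - g ω π) = 0 := fun π hπ => by
    rw [Finset.sum_sub_distrib, ← Finset.sum_mul, hπ.2, one_mul, sub_self]
  obtain ⟨π, hπ, hle⟩ := exists_mem_stdSimplex_forall_nonpos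
    (fun ω π => π ω * ∑ j, g j π - g ω π)
    (fun ω => ((continuous_apply ω).continuousOn.mul
      (continuousOn_finsetSum _ fun j _ => hg j)).sub (hg ω))
    (fun π hπ => by
      by_contra! h
      have := Finset.sum_pos (fun ω (_ : ω ∈ Finset.univ) => h ω) Finset.univ_nonempty
      exact this.ne' (htotal π hπ))
    (fun π _ ω hω => by simpa [hω] using hg0 ω π)
  refine ⟨π, hπ, ?_⟩
  have heq : ∀ ω, π ω * ∑ j, g j π = g ω π := fun ω =>
    sub_eq_zero.1 ((Finset.sum_eq_zero_iff_of_nonpos fun ω _ => hle ω).1 (htotal π hπ) ω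
      (Finset.mem_univ ω))
  have hS : ∑ j, g j π ≤ 0 := by
    by_contra! hS
    have hlt : ∀ ω, 0 < π ω → C < q π ω := fun ω hω => by
      have : 0 < g ω π := heq ω ▸ mul_pos hω hS
      rcases lt_max_iff.1 this with h | h
      · linarith
      · exact absurd h (lt_irrefl 0)
    obtain ⟨ω₀, -, hω₀⟩ := Finset.exists_lt_of_sum_lt (s := Finset.univ) (f := fun _ : Ω => (0 : ℝ))
      (g := π) (by rw [hπ.2]; simp)
    have : ∑ ω, π ω * C < ∑ ω, π ω * q π ω := by
      refine Finset.sum_lt_sum (fun ω _ => ?_)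
        ⟨ω₀, Finset.mem_univ _, mul_lt_mul_of_pos_left (hlt ω₀ hω₀) hω₀⟩
      rcases (hπ.1 ω).eq_or_lt with h | h
      · simp [← h]
      · exact (mul_lt_mul_of_pos_left (hlt ω h) h).le
    rw [← Finset.sum_mul, hπ.2, one_mul] at this
    exact absurd (hsum π hπ) (not_le.2 this)
  intro ω
  have h1 : g ω π ≤ 0 := (Finset.single_le_sum (fun j _ => hg0 j π) (Finset.mem_univ ω)).trans hS
  linarith [le_max_left (q π ω - C) 0, show max (q π ω - C) 0 ≤ 0 from h1]
end
end

section
/- Let Ω be a finite nonempty set, Λ ⊆ [0,∞]^Ω with superprediction set Σ_Λ, c ≥ 1 and η > 0 reals, and λ : 𝒫(Ω) → Σ_Λ a map such that for every g ∈ Σ_Λ the function q_g(π,ω) := exp(η·λ(π)(ω)/c)·exp(−η·g(ω)) is forecast-continuous and has the supermartingale property. Then the Aggregating Algorithm is (c,η)-realizable for (Ω,Λ): for every k ≥ 1, all g_1,…,g_k ∈ Σ_Λ and all reals ρ_i ≥ 0 with ∑_{i=1}^k ρ_i = 1, there exists γ ∈ Σ_Λ such that exp(η·γ(ω)/c)·∑_{i=1}^k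 ρ_i·exp(−η·g_i(ω)) ≤ 1 for all ω ∈ Ω. -/
open scoped ENNReal BigOperators
open Filter

noncomputable section

variable {Ω : Type*} [Fintype Ω]

/-- A finite set `σ` is dominant for the family of orders induced by `u` if no point exceeds `σ`
strictly in every order. -/
def IsDominant {I X : Type*} (u : I → X → ℤ) (σ : Finset X) : Prop :=
  ∀ t, ∃ i, ∀ s ∈ σ, u i t ≤ u i s

lemma IsDominant.mono {I X : Type*} {u : I → X → ℤ} {σ τ : Finset X}
    (h : IsDominant u σ) (hτ : τ ⊆ σ) : IsDominant u τ := fun t =>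
  (h t).imp fun _ hi s hs => hi s (hτ hs)

/-- A dominant set with one element fewer than there are orders, for which all the order-wise
strict upper regions with one order left out are nonempty, has exactly two dominant one-point
extensions. -/
lemma IsDominant.card_extensions_eq_two {I X : Type*} [Fintype I] [DecidableEq I] [Fintype X]
    [DecidableEq X] {u : I → X → ℤ} (hu : ∀ i, Function.Injective (u i)) {τ : Finset X}
    (hτ : IsDominant u τ) (hne : τ.Nonempty) (hcard : τ.card + 1 = Fintype.card I)
    (hbig : ∀ k, ∃ x, ∀ l ≠ k, ∃ s ∈ τ, u l s < u l x)
    (R : Finset X) (hR : ∀ x, x ∈ R ↔ x ∉ τ ∧ IsDominant u (insert x τ)) :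
    R.card = 2 := by
  classical
  choose m hmτ hm using fun i => Finset.exists_min_image τ (u i) hne
  have hmeq : ∀ i, ∀ s ∈ τ, (∀ s' ∈ τ, u i s ≤ u i s') → m i = s := fun i s hs h =>
    hu i (le_antisymm (hm i s hs) (h _ (hmτ i)))
  have hsurj : ∀ s ∈ τ, ∃ i, m i = s := fun s hs => by
    obtain ⟨i, hi⟩ := hτ s
    exact ⟨i, hmeq i s hs hi⟩
  obtain ⟨a, -, b, -, hab, hmab⟩ := Finset.exists_ne_map_eq_of_card_lt_of_maps_to
    (s := Finset.univ) (t := τ) (f := m) (by rw [Finset.card_univ]; omega)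
    (fun i _ => hmτ i)
  have himg : ∀ p q, p ≠ q → m p = m q → (Finset.univ.erase p).image m = τ := by
    intro p q hpq h
    ext s
    simp only [Finset.mem_image, Finset.mem_erase, Finset.mem_univ, and_true]
    constructor
    · rintro ⟨i, -, rfl⟩
      exact hmτ i
    · intro hs
      obtain ⟨i, rfl⟩ := hsurj s hs
      by_cases hi : i = p
      · exact ⟨q, hpq.symm, by rw [hi, h]⟩
      · exact ⟨i, hi, rfl⟩
  have hinj : ∀ p q, p ≠ q → m p = m q → ∀ k l, k ≠ p → l ≠ p → m k = m l → k = l := by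
    intro p q hpq h k l hk hl hkl
    have := Finset.injOn_of_card_image_eq (s := Finset.univ.erase p) (f := m) (by
      rw [himg p q hpq h, Finset.card_erase_of_mem (Finset.mem_univ _), Finset.card_univ]; omega)
    exact this (by simpa using hk) (by simpa using hl) hkl
  -- the points above all minima except possibly in order `k`
  let S : I → Finset X := fun k => Finset.univ.filter fun x => ∀ l ≠ k, u l (m l) < u l x
  have hS : ∀ k x, x ∈ S k ↔ ∀ l ≠ k, u l (m l) < u l x := fun k x => by simp [S]
  have hSne : ∀ k, (S k).Nonempty := by
    intro k
    obtain ⟨x, hx⟩ := hbig k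
    refine ⟨x, (hS k x).2 fun l hl => ?_⟩
    obtain ⟨s, hs, hlt⟩ := hx l hl
    exact (hm l s hs).trans_lt hlt
  have hSlow : ∀ k, ∀ x ∈ S k, u k x ≤ u k (m k) := by
    intro k x hx
    obtain ⟨i, hi⟩ := hτ x
    by_cases hik : i = k
    · subst hik
      exact hi _ (hmτ i)
    · exact absurd ((hS k x).1 hx i hik) (not_lt.2 (hi _ (hmτ i)))
  choose z hzS hz using fun k => Finset.exists_max_image (S k) (u k) (hSne k)
  have hzR : ∀ p q, p ≠ q → m p = m q → z p ∈ R := by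
    intro p q hpq h
    have hzp := (hS p _).1 (hzS p)
    refine (hR _).2 ⟨fun hmem => ?_, fun t => ?_⟩
    · rw [← himg p q hpq h, Finset.mem_image] at hmem
      obtain ⟨l, hl, hl'⟩ := hmem
      have := hzp l (Finset.ne_of_mem_erase hl)
      rw [hl'] at this
      exact lt_irrefl _ this
    · by_cases ht : t ∈ S p
      · refine ⟨p, fun s hs => ?_⟩
        rcases Finset.mem_insert.1 hs with rfl | hs
        · exact hz p t ht
        · exact (hSlow p t ht).trans (hm p s hs)
      · rw [hS] at ht
        push Not at ht
        obtain ⟨l, hl, hlt⟩ := ht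
        refine ⟨l, fun s hs => ?_⟩
        rcases Finset.mem_insert.1 hs with rfl | hs
        · exact hlt.trans (hzp l hl).le
        · exact hlt.trans (hm l s hs)
  have hRz : ∀ x ∈ R, x = z a ∨ x = z b := by
    intro x hx
    obtain ⟨hxτ, hx⟩ := (hR x).1 hx
    have hnex : ∀ l, m l ≠ x := fun l h => hxτ (h ▸ hmτ l)
    have hstep : ∀ k, u k x ≤ u k (m k) → ∃ l ≠ k, m l = m k ∧ u l (m l) ≤ u l x := by
      intro k hk
      obtain ⟨l, hl⟩ := hx (m k)
      have hml := hmeq l (m k) (hmτ k) fun s hs => hl s (Finset.mem_insert_of_mem hs)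
      have hlx := hl x (Finset.mem_insert_self _ _)
      refine ⟨l, ?_, hml, hml ▸ hlx⟩
      rintro rfl
      exact hnex l (hu l (le_antisymm hlx hk))
    obtain ⟨k, hk⟩ := hx x
    have hkm : ∀ s ∈ τ, u k x ≤ u k s := fun s hs => hk s (Finset.mem_insert_of_mem hs)
    obtain ⟨l, hlk, hml, -⟩ := hstep k (hkm _ (hmτ k))
    have hkab : k = a ∨ k = b := by
      by_contra! hcon
      obtain ⟨hka, hkb⟩ := hcon
      by_cases hla : l = a
      · subst hla
        exact hkb (hinj l b hab hmab k b hka hab.symm (hml.symm.trans hmab))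
      · exact hlk (hinj a b hab hmab l k hla hka hml)
    have hxS : x ∈ S k := by
      rw [hS]
      intro j hj
      by_contra! hle
      obtain ⟨i, hij, hmi, hix⟩ := hstep j hle
      have hik : i ≠ k := by
        rintro rfl
        exact hnex i (hu i (le_antisymm hix (hkm _ (hmτ i))))
      exact hij (hinj k l hlk.symm hml.symm i j hik hj hmi)
    have hxz : x = z k := by
      apply hu k
      refine le_antisymm (hz k x hxS) ?_
      obtain ⟨i, hi⟩ := hx (z k)
      have hik : i = k := by
        by_contra hik
        exact absurd ((hS k _).1 (hzS k) i hik)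
          (not_lt.2 (hi _ (Finset.mem_insert_of_mem (hmτ i))))
      subst hik
      exact hi x (Finset.mem_insert_self _ _)
    rcases hkab with rfl | rfl
    · exact Or.inl hxz
    · exact Or.inr hxz
  have hzab : z a ≠ z b := by
    intro h
    have h1 := (hS b _).1 (hzS b) a hab
    rw [← h] at h1
    exact absurd h1 (not_lt.2 (hSlow a _ (hzS a)))
  rw [← Finset.card_pair hzab]
  congr 1
  ext x
  rw [Finset.mem_insert, Finset.mem_singleton]
  refine ⟨hRz x, ?_⟩
  rintro (rfl | rfl)
  · exact hzR a b hab hmab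
  · exact hzR b a hab.symm hmab.symm

/-- If the colouring of a set of `card I` points is not onto, then an even number of its facets
carry exactly the colours different from `i₀`. -/
lemma even_card_facets {I X : Type*} [Fintype I] [DecidableEq I] [DecidableEq X] (c : X → I)
    (i₀ : I) (σ : Finset X) (hσ : σ.card = Fintype.card I) (hc : σ.image c ≠ Finset.univ) :
    Even (σ.filter fun s => (σ.erase s).image c = Finset.univ.erase i₀).card := by
  rcases Finset.eq_empty_or_nonempty
    (σ.filter fun s => (σ.erase s).image c = Finset.univ.erase i₀) with h | ⟨s, hs⟩
  · simp [h]
  obtain ⟨hsσ, hs⟩ := Finset.mem_filter.1 hs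
  have hinj : Set.InjOn c (σ.erase s) := Finset.injOn_of_card_image_eq (by
    rw [hs, Finset.card_erase_of_mem (Finset.mem_univ _), Finset.card_erase_of_mem hsσ, hσ,
      Finset.card_univ])
  have hcs : c s ≠ i₀ := by
    intro h
    apply hc
    rw [← Finset.insert_erase hsσ, Finset.image_insert, hs, h,
      Finset.insert_erase (Finset.mem_univ _)]
  have hmem : c s ∈ (σ.erase s).image c := by simpa [hs] using hcs
  obtain ⟨s', hs', hss'⟩ := Finset.mem_image.1 hmem
  obtain ⟨hne, hs'σ⟩ := Finset.mem_erase.1 hs'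
  suffices h : (σ.filter fun s => (σ.erase s).image c = Finset.univ.erase i₀) = {s, s'} by
    rw [h, Finset.card_pair hne.symm]
    exact even_two
  ext t
  simp only [Finset.mem_filter, Finset.mem_insert, Finset.mem_singleton]
  constructor
  · rintro ⟨htσ, ht⟩
    by_contra! hcon
    obtain ⟨h1, h2⟩ := hcon
    have hct : c t ∈ (σ.erase t).image c := by
      rw [ht, ← hs]
      exact Finset.mem_image_of_mem c (Finset.mem_erase.2 ⟨h1, htσ⟩)
    obtain ⟨r, hr, hrt⟩ := Finset.mem_image.1 hct
    obtain ⟨hrt', hrσ⟩ := Finset.mem_erase.1 hr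
    by_cases hrs : r = s
    · subst hrs
      exact h2 (hinj (by simp [h1, htσ]) (by simp [hne, hs'σ]) (hrt.symm.trans hss'.symm))
    · exact hrt' (hinj (by simp [hrs, hrσ]) (by simp [h1, htσ]) hrt)
  · rintro (rfl | rfl)
    · exact ⟨hsσ, hs⟩
    · refine ⟨hs'σ, ?_⟩
      rw [← hs]
      ext i
      simp only [Finset.mem_image, Finset.mem_erase]
      constructor
      · rintro ⟨r, ⟨hr, hrσ⟩, rfl⟩
        by_cases hrs : r = s
        · exact ⟨t, ⟨hne, hs'σ⟩, by rw [hss', hrs]⟩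
        · exact ⟨r, ⟨hrs, hrσ⟩, rfl⟩
      · rintro ⟨r, ⟨hr, hrσ⟩, rfl⟩
        by_cases hrs : r = t
        · exact ⟨s, ⟨hne.symm, hsσ⟩, by rw [← hss', hrs]⟩
        · exact ⟨r, ⟨hrs, hrσ⟩, rfl⟩

/-- Scarf's combinatorial form of Sperner's lemma: a colouring which is the identity on the slack
points `e i` admits a dominant set carrying every colour exactly once. -/
theorem exists_isDominant_image_eq_univ {I X : Type*} [Fintype I] [DecidableEq I] [Nontrivial I]
    [Fintype X] [DecidableEq X] (u : I → X → ℤ) (hu : ∀ i, Function.Injective (u i)) (e : I → X)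
    (he_le : ∀ i x, u i (e i) ≤ u i x)
    (he_lt : ∀ i j x, i ≠ j → x ∉ Set.range e → u i x < u i (e j))
    (hX : ∃ x, x ∉ Set.range e) (c : X → I) (hc : ∀ i, c (e i) = i) :
    ∃ σ : Finset X, IsDominant u σ ∧ σ.card = Fintype.card I ∧ σ.image c = Finset.univ := by
  classical
  by_contra! hno
  obtain ⟨i₀, -⟩ := exists_pair_ne I
  have heinj : Function.Injective e := Function.LeftInverse.injective hc
  let good : Finset X → Prop := fun τ =>
    IsDominant u τ ∧ τ.card + 1 = Fintype.card I ∧ τ.image c = Finset.univ.erase i₀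
  let G : Finset (Finset X) := Finset.univ.filter good
  let R : Finset X → Finset X := fun τ =>
    Finset.univ.filter fun x => x ∉ τ ∧ IsDominant u (insert x τ)
  let D : Finset (Finset X) := Finset.univ.filter fun σ =>
    IsDominant u σ ∧ σ.card = Fintype.card I
  let F : Finset X → Finset X := fun σ =>
    σ.filter fun s => (σ.erase s).image c = Finset.univ.erase i₀
  have hG : ∀ τ, τ ∈ G ↔ good τ := fun τ => by simp [G]
  have hR : ∀ τ x, x ∈ R τ ↔ x ∉ τ ∧ IsDominant u (insert x τ) := fun τ x => by simp [R]
  have hD : ∀ σ, σ ∈ D ↔ IsDominant u σ ∧ σ.card = Fintype.card I := fun σ => by simp [D]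
  have hF : ∀ σ s, s ∈ F σ ↔ s ∈ σ ∧ (σ.erase s).image c = Finset.univ.erase i₀ :=
    fun σ s => by simp [F]
  have hcount : (G.sigma R).card = (D.sigma F).card := by
    refine Finset.card_bij' (fun p _ => ⟨insert p.2 p.1, p.2⟩) (fun p _ => ⟨p.1.erase p.2, p.2⟩)
      ?_ ?_ ?_ ?_
    · rintro ⟨τ, x⟩ h
      simp only [Finset.mem_sigma, hG, hR, hD, hF, good] at h ⊢
      obtain ⟨⟨-, h2, h3⟩, h4, h5⟩ := h
      exact ⟨⟨h5, by rw [Finset.card_insert_of_notMem h4, h2]⟩, Finset.mem_insert_self _ _,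
        by rw [Finset.erase_insert h4, h3]⟩
    · rintro ⟨σ, s⟩ h
      simp only [Finset.mem_sigma, hG, hR, hD, hF, good] at h ⊢
      obtain ⟨⟨h1, h2⟩, h3, h4⟩ := h
      exact ⟨⟨h1.mono (Finset.erase_subset _ _), by rw [Finset.card_erase_add_one h3, h2], h4⟩,
        Finset.notMem_erase _ _, by rwa [Finset.insert_erase h3]⟩
    · rintro ⟨τ, x⟩ h
      simp only [Finset.mem_sigma, hR] at h
      simp [Finset.erase_insert h.2.1]
    · rintro ⟨σ, s⟩ h
      simp only [Finset.mem_sigma, hF] at h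
      simp [Finset.insert_erase h.2.1]
  have heven : Even (D.sigma F).card := by
    rw [Finset.card_sigma]
    refine Finset.even_sum _ fun σ hσ => ?_
    obtain ⟨h1, h2⟩ := (hD σ).1 hσ
    exact even_card_facets c i₀ σ h2 (hno σ h1 h2)
  let τ₀ : Finset X := (Finset.univ.erase i₀).image e
  have hτ₀mem : ∀ x, x ∈ τ₀ ↔ ∃ k ≠ i₀, e k = x := fun x => by simp [τ₀]
  have hτ₀low : ∀ t ∉ τ₀, ∀ s ∈ τ₀, u i₀ t ≤ u i₀ s := by
    intro t ht s hs
    obtain ⟨k, hk, rfl⟩ := (hτ₀mem s).1 hs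
    by_cases htr : t ∈ Set.range e
    · obtain ⟨l, rfl⟩ := htr
      have hl : l = i₀ := by
        by_contra hl
        exact ht ((hτ₀mem _).2 ⟨l, hl, rfl⟩)
      rw [hl]
      exact he_le _ _
    · exact (he_lt i₀ k t hk.symm htr).le
  have hτ₀dom : IsDominant u τ₀ := by
    intro t
    by_cases ht : t ∈ τ₀
    · obtain ⟨k, hk, rfl⟩ := (hτ₀mem t).1 ht
      exact ⟨k, fun s _ => he_le _ _⟩
    · exact ⟨i₀, hτ₀low t ht⟩
  have hτ₀good : good τ₀ := by
    refine ⟨hτ₀dom, ?_, ?_⟩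
    · rw [Finset.card_image_of_injective _ heinj, Finset.card_erase_add_one (Finset.mem_univ _),
        Finset.card_univ]
    · rw [Finset.image_image, show c ∘ e = id from funext hc, Finset.image_id]
  have hτ₀one : (R τ₀).card = 1 := by
    obtain ⟨x₁, hx₁⟩ := hX
    have hx₁' : x₁ ∈ τ₀ᶜ := by
      rw [Finset.mem_compl, hτ₀mem]
      rintro ⟨k, -, rfl⟩
      exact hx₁ ⟨k, rfl⟩
    obtain ⟨z, hz, hzmax⟩ := Finset.exists_max_image τ₀ᶜ (u i₀) ⟨x₁, hx₁'⟩
    rw [Finset.mem_compl] at hz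
    rw [Finset.card_eq_one]
    refine ⟨z, ?_⟩
    ext x
    rw [hR, Finset.mem_singleton]
    constructor
    · rintro ⟨hx, hxd⟩
      apply hu i₀
      refine le_antisymm (hzmax x (Finset.mem_compl.2 hx)) ?_
      obtain ⟨l, hl⟩ := hxd z
      by_cases hli : l = i₀
      · subst hli
        exact hl x (Finset.mem_insert_self _ _)
      · have hel : e l ∈ τ₀ := (hτ₀mem _).2 ⟨l, hli, rfl⟩
        have := hu l (le_antisymm (hl _ (Finset.mem_insert_of_mem hel)) (he_le l z))
        exact absurd (this ▸ hel) hz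
    · rintro rfl
      refine ⟨hz, fun t => ?_⟩
      by_cases ht : t ∈ τ₀
      · obtain ⟨k, hk, rfl⟩ := (hτ₀mem t).1 ht
        exact ⟨k, fun s _ => he_le _ _⟩
      · refine ⟨i₀, fun s hs => ?_⟩
        rcases Finset.mem_insert.1 hs with rfl | hs
        · exact hzmax t (Finset.mem_compl.2 ht)
        · exact hτ₀low t ht s hs
  have hother : ∀ τ ∈ G.erase τ₀, Even (R τ).card := by
    intro τ hτ
    obtain ⟨hne, hτ⟩ := Finset.mem_erase.1 hτ
    obtain ⟨h1, h2, h3⟩ := (hG τ).1 hτ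
    have hy : ∃ y ∈ τ, y ∉ Set.range e := by
      by_contra! hcon
      apply hne
      refine Finset.eq_of_subset_of_card_le (fun x hx => ?_) (by have := hτ₀good.2.1; omega)
      obtain ⟨k, rfl⟩ := hcon x hx
      refine (hτ₀mem _).2 ⟨k, ?_, rfl⟩
      have := Finset.mem_image_of_mem c hx
      rw [h3, hc] at this
      exact Finset.ne_of_mem_erase this
    obtain ⟨y, hyτ, hy⟩ := hy
    rw [h1.card_extensions_eq_two hu ⟨y, hyτ⟩ h2
      (fun k => ⟨e k, fun l hl => ⟨y, hyτ, he_lt l k y hl hy⟩⟩) (R τ) (hR τ)]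
    exact even_two
  have hodd : Odd (G.sigma R).card := by
    rw [Finset.card_sigma, ← Finset.add_sum_erase G _ ((hG _).2 hτ₀good), hτ₀one]
    exact Even.one_add (Finset.even_sum _ hother)
  rw [hcount] at hodd
  exact (Nat.not_even_iff_odd.2 hodd) heven

/-- Every colouring of the lattice points of the `N`-fold dilated standard simplex has a lattice
point which, for every colour `i`, is close to the face opposite `i` or to a point of colour `i`. -/
theorem exists_lattice_point_near_colors {I : Type*} [Fintype I] [DecidableEq I] [Nontrivial I]
    (N : ℕ) (c : (I → ℕ) → I) :
    ∃ s : I → ℕ, ∑ i, s i = N ∧ ∀ i, s i < Fintype.card I ∨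
      ∃ s' : I → ℕ, ∑ i, s' i = N ∧ c s' = i ∧
        ∀ j, s j < s' j + Fintype.card I ∧ s' j < s j + Fintype.card I := by
  classical
  let T := {t : I → Fin (N + 1) // ∑ i, (t i : ℕ) = N}
  have hmkT : ∀ t : I → ℕ, ∑ i, t i = N → ∃ t' : T, ∀ i, (t'.1 i : ℕ) = t i := by
    intro t ht
    refine ⟨⟨fun i => ⟨t i, ?_⟩, ht⟩, fun i => rfl⟩
    have := Finset.single_le_sum (fun j _ => Nat.zero_le (t j)) (Finset.mem_univ i)
    omega
  obtain ⟨i₁, -⟩ := exists_pair_ne I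
  obtain ⟨t₀, -⟩ := hmkT (fun i => if i = i₁ then N else 0) (by simp)
  let M : ℤ := Fintype.card T
  let idx : T → ℤ := fun t => (Fintype.equivFin T t : ℕ)
  have hidx0 : ∀ t, 0 ≤ idx t := fun t => Int.natCast_nonneg _
  have hidxM : ∀ t, idx t < M := fun t => Int.ofNat_lt.2 (Fintype.equivFin T t).2
  have hidxinj : ∀ t t', idx t = idx t' → t = t' := fun t t' h =>
    (Fintype.equivFin T).injective (Fin.ext (Int.ofNat_inj.1 h))
  let idx' : I → ℤ := fun t => (Fintype.equivFin I t : ℕ)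
  have hidx'0 : ∀ t, 0 ≤ idx' t := fun t => Int.natCast_nonneg _
  have hidx'inj : ∀ t t', idx' t = idx' t' → t = t' := fun t t' h =>
    (Fintype.equivFin I).injective (Fin.ext (Int.ofNat_inj.1 h))
  let u : I → T ⊕ I → ℤ := fun i => Sum.elim (fun t => ((t.1 i : ℕ) : ℤ) * M + idx t)
    fun j => if j = i then -1 else (N + 1) * M + idx' j
  have hul : ∀ i t, u i (Sum.inl t) = ((t.1 i : ℕ) : ℤ) * M + idx t := fun i t => rfl
  have hus : ∀ i, u i (Sum.inr i) = -1 := fun i => by simp [u]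
  have hur : ∀ i j, j ≠ i → u i (Sum.inr j) = (N + 1) * M + idx' j := fun i j h => by simp [u, h]
  have hM : 0 < M := (hidx0 t₀).trans_lt (hidxM t₀)
  have hu0 : ∀ i t, 0 ≤ u i (Sum.inl t) := fun i t => by
    rw [hul]; have := hidx0 t; positivity
  have hulr : ∀ i j t, j ≠ i → u i (Sum.inl t) < u i (Sum.inr j) := by
    intro i j t hij
    rw [hul, hur i j hij]
    have h1 : ((t.1 i : ℕ) : ℤ) ≤ N := by have := (t.1 i).2; omega
    nlinarith [hidxM t, hidx'0 j]
  have hur0 : ∀ i j, j ≠ i → 0 ≤ u i (Sum.inr j) := fun i j h =>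
    (hu0 i t₀).trans (hulr i j t₀ h).le
  have huinj : ∀ i, Function.Injective (u i) := by
    rintro i (t | j) (t' | j') h
    · rw [hul, hul] at h
      have hmod := congrArg (· % M) h
      simp only [Int.mul_add_emod_self_right, Int.emod_eq_of_lt (hidx0 _) (hidxM _)] at hmod
      rw [hidxinj _ _ hmod]
    · by_cases hj : j' = i
      · subst hj
        have := hu0 j' t
        have := hus j'
        omega
      · exact absurd h (hulr i j' t hj).ne
    · by_cases hj : j = i
      · subst hj
        have := hu0 j t'
        have := hus j
        omega
      · exact absurd h (hulr i j t' hj).ne'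
    · by_cases hj : j = i <;> by_cases hj' : j' = i
      · rw [hj, hj']
      · subst hj
        have := hur0 j j' hj'
        have := hus j
        omega
      · subst hj'
        have := hur0 j' j hj
        have := hus j'
        omega
      · rw [hur i j hj, hur i j' hj'] at h
        rw [hidx'inj j j' (by linarith)]
  let c' : T ⊕ I → I := Sum.elim (fun t => c fun i => t.1 i) id
  obtain ⟨σ, hdom, -, himg⟩ := exists_isDominant_image_eq_univ u huinj Sum.inr
    (by
      rintro i (t | j)
      · rw [hus]; linarith [hu0 i t]
      · by_cases hj : j = i
        · rw [hj]
        · rw [hus]; linarith [hur0 i j hj])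
    (by
      rintro i j (t | k) hij hk
      · exact hulr i j t hij.symm
      · exact absurd ⟨k, rfl⟩ hk)
    ⟨Sum.inl t₀, by simp⟩ c' (fun i => rfl)
  have hcol : ∀ i, Sum.inr i ∉ σ → ∃ t, Sum.inl t ∈ σ ∧ c (fun j => t.1 j) = i := by
    intro i hi
    have : i ∈ σ.image c' := himg ▸ Finset.mem_univ i
    obtain ⟨t | j, hp, hpi⟩ := Finset.mem_image.1 this
    · exact ⟨t, hp, hpi⟩
    · have hji : j = i := hpi
      exact absurd (hji ▸ hp) hi
  obtain ⟨s, hs⟩ : ∃ s, Sum.inl s ∈ σ := by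
    obtain ⟨i, hi⟩ := hdom (Sum.inl t₀)
    obtain ⟨t, ht, -⟩ := hcol i fun h => by
      have := hi _ h
      rw [hus] at this
      linarith [hu0 i t₀]
    exact ⟨t, ht⟩
  have hb : ∀ i, ∃ b : ℕ, (∀ t, Sum.inl t ∈ σ → b ≤ (t.1 i : ℕ) + 1) ∧
      (∀ t : T, b ≤ (t.1 i : ℕ) → ∃ p ∈ σ, u i p < u i (Sum.inl t)) ∧
      (Sum.inr i ∈ σ → b = 0) := by
    intro i
    by_cases hi : Sum.inr i ∈ σ
    · exact ⟨0, fun t _ => Nat.zero_le _, fun t _ => ⟨_, hi, by rw [hus]; linarith [hu0 i t]⟩,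
        fun _ => rfl⟩
    · obtain ⟨r, hr, hmin⟩ := Finset.exists_min_image
        (Finset.univ.filter fun t : T => Sum.inl t ∈ σ) (fun t => (t.1 i : ℕ)) ⟨s, by simpa using hs⟩
      simp only [Finset.mem_filter, Finset.mem_univ, true_and] at hr hmin
      refine ⟨(r.1 i : ℕ) + 1, fun t ht => by have := hmin t ht; omega, fun t ht => ?_,
        fun h => absurd h hi⟩
      refine ⟨_, hr, ?_⟩
      rw [hul, hul]
      have h1 : ((r.1 i : ℕ) : ℤ) + 1 ≤ ((t.1 i : ℕ) : ℤ) := by exact_mod_cast ht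
      nlinarith [hidxM r, hidx0 t]
  choose b hb1 hb2 hb3 using hb
  have hbsum : N < ∑ i, b i := by
    by_contra! hle
    obtain ⟨t, ht⟩ := hmkT (fun i => b i + if i = i₁ then N - ∑ i, b i else 0) (by
      rw [Finset.sum_add_distrib]
      simp only [Finset.sum_ite_eq', Finset.mem_univ, if_true]
      omega)
    obtain ⟨i, hi⟩ := hdom (Sum.inl t)
    obtain ⟨p, hp, hlt⟩ := hb2 i t (by rw [ht]; omega)
    exact absurd (hi p hp) (not_le.2 hlt)
  have hup : ∀ t, Sum.inl t ∈ σ → ∀ j, (t.1 j : ℕ) + 2 ≤ Fintype.card I + b j := by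
    intro t ht j
    have h1 : ∑ i, ((t.1 i : ℕ) + 1) = N + Fintype.card I := by
      rw [Finset.sum_add_distrib, t.2]; simp
    have h2 : ∑ i ∈ Finset.univ.erase j, b i ≤ ∑ i ∈ Finset.univ.erase j, ((t.1 i : ℕ) + 1) :=
      Finset.sum_le_sum fun i _ => hb1 i t ht
    rw [← Finset.add_sum_erase _ _ (Finset.mem_univ j)] at h1 hbsum
    omega
  refine ⟨fun i => s.1 i, s.2, fun i => ?_⟩
  by_cases hi : Sum.inr i ∈ σ
  · left
    have h1 := hup s hs i
    have h2 := hb3 i hi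
    show (s.1 i : ℕ) < _
    omega
  · right
    obtain ⟨t, ht, hci⟩ := hcol i hi
    refine ⟨fun i => t.1 i, t.2, hci, fun j => ?_⟩
    have h1 := hup s hs j
    have h2 := hup t ht j
    have h3 := hb1 j s hs
    have h4 := hb1 j t ht
    show (s.1 j : ℕ) < (t.1 j : ℕ) + _ ∧ (t.1 j : ℕ) < (s.1 j : ℕ) + _
    omega

/-- A Knaster–Kuratowski–Mazurkiewicz type theorem: closed conditions `0 ≤ h i`, at least one of
which holds at each point of the simplex and the `i`-th of which holds on the face opposite to `i`,
hold simultaneously at some point. -/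
theorem exists_mem_stdSimplex_forall_nonneg {I : Type*} [Fintype I] [Nontrivial I]
    (h : I → (I → ℝ) → ℝ) (hcont : ∀ i, ContinuousOn (h i) (stdSimplex ℝ I))
    (hcover : ∀ x ∈ stdSimplex ℝ I, ∃ i, 0 ≤ h i x)
    (hface : ∀ x ∈ stdSimplex ℝ I, ∀ i, x i = 0 → 0 ≤ h i x) :
    ∃ x ∈ stdSimplex ℝ I, ∀ i, 0 ≤ h i x := by
  classical
  let pt : ℕ → (I → ℕ) → I → ℝ := fun N s i => (s i : ℝ) / (N + 1 : ℕ)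
  have hpt : ∀ N s, ∑ i, s i = N + 1 → pt N s ∈ stdSimplex ℝ I := by
    intro N s hs
    refine ⟨fun i => by positivity, ?_⟩
    rw [← Finset.sum_div, ← Nat.cast_sum, hs]
    exact div_self (by positivity)
  have hcol : ∀ N, ∃ c : (I → ℕ) → I, ∀ s, ∑ i, s i = N + 1 → 0 ≤ h (c s) (pt N s) := by
    intro N
    choose c hc using fun s : I → ℕ => show ∃ i, ∑ i, s i = N + 1 → 0 ≤ h i (pt N s) from by
      by_cases hs : ∑ i, s i = N + 1
      · exact (hcover _ (hpt N s hs)).imp fun i hi _ => hi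
      · exact ⟨Classical.arbitrary I, fun h => absurd h hs⟩
    exact ⟨c, hc⟩
  choose c hc using hcol
  choose s hs hsnear using fun N => exists_lattice_point_near_colors (N + 1) (c N)
  set n := Fintype.card I
  obtain ⟨x, hx, φ, hφ, hlim⟩ := (isCompact_stdSimplex ℝ I).tendsto_subseq
    fun N => hpt N (s N) (hs N)
  have hsmall : Tendsto (fun N : ℕ => (n : ℝ) / (φ N + 1 : ℕ)) atTop (nhds 0) := by
    refine Tendsto.comp (g := fun k : ℕ => (n : ℝ) / k) (tendsto_const_div_atTop_nhds_zero_nat _) ?_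
    exact (tendsto_add_atTop_nat 1).comp hφ.tendsto_atTop
  refine ⟨x, hx, fun i => ?_⟩
  by_cases hxi : x i = 0
  · exact hface x hx i hxi
  have hxpos : 0 < x i := lt_of_le_of_ne (hx.1 i) (Ne.symm hxi)
  have hy : ∀ N, ∃ y ∈ stdSimplex ℝ I,
      (∀ j, |y j - pt N (s N) j| ≤ (n : ℝ) / (N + 1 : ℕ)) ∧
      ((n : ℝ) / (N + 1 : ℕ) < pt N (s N) i → 0 ≤ h i y) := by
    intro N
    have hN : (0 : ℝ) < (N + 1 : ℕ) := by positivity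
    rcases hsnear N i with hlt | ⟨s', hs', hci, hclose⟩
    · refine ⟨_, hpt N (s N) (hs N), fun j => by rw [sub_self, abs_zero]; positivity,
        fun hlt' => ?_⟩
      have := (div_lt_div_iff_of_pos_right hN).1 hlt'
      exact absurd (Nat.cast_lt.1 this) (not_lt.2 hlt.le)
    · refine ⟨_, hpt N s' hs', fun j => ?_, fun _ => hci ▸ hc N s' hs'⟩
      obtain ⟨h1, h2⟩ := hclose j
      have h1' : ((s N j : ℕ) : ℝ) ≤ s' j + n := by exact_mod_cast h1.le
      have h2' : ((s' j : ℕ) : ℝ) ≤ s N j + n := by exact_mod_cast h2.le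
      simp only [pt]
      rw [← sub_div, abs_div, abs_of_pos hN]
      gcongr
      rw [abs_le]
      constructor <;> linarith
  choose y hymem hyclose hyh using hy
  have hylim : Tendsto (fun N => y (φ N)) atTop (nhds x) := by
    rw [tendsto_pi_nhds]
    intro j
    have h1 : Tendsto (fun N => y (φ N) j - pt (φ N) (s (φ N)) j) atTop (nhds 0) :=
      squeeze_zero_norm (fun N => hyclose (φ N) j) hsmall
    simpa using h1.add ((tendsto_pi_nhds.1 hlim) j)
  have hhlim : Tendsto (fun N => h i (y (φ N))) atTop (nhds (h i x)) :=
    (hcont i x hx).tendsto.comp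
      (tendsto_nhdsWithin_iff.2 ⟨hylim, Eventually.of_forall fun N => hymem (φ N)⟩)
  refine ge_of_tendsto hhlim ?_
  filter_upwards [hsmall.eventually_lt ((tendsto_pi_nhds.1 hlim) i) hxpos] with N hN
  exact hyh (φ N) hN

/-- Levin's lemma: a forecast-continuous function with the supermartingale property is bounded by
`1` at some forecast. -/
theorem exists_forall_le_one_of_expect_le_one {I : Type*} [Fintype I] [Nonempty I]
    (q : (I → ℝ) → I → ℝ≥0∞) (hcont : ∀ i, ContinuousOn (fun π => q π i) (stdSimplex ℝ I))
    (hq : ∀ π ∈ stdSimplex ℝ I, expect π (q π) ≤ 1) :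
    ∃ π ∈ stdSimplex ℝ I, ∀ i, q π i ≤ 1 := by
  classical
  rcases subsingleton_or_nontrivial I with hI | hI
  · have hmem : (fun _ => 1 : I → ℝ) ∈ stdSimplex ℝ I := by
      refine ⟨fun _ => zero_le_one, ?_⟩
      rw [Fintype.sum_subsingleton _ (Classical.arbitrary I)]
    refine ⟨_, hmem, fun i => ?_⟩
    have := hq _ hmem
    rw [expect, Fintype.sum_subsingleton _ i] at this
    simpa using this
  -- the excess of `q` over `1`, truncated so as to be real-valued
  let p : I → (I → ℝ) → ℝ := fun i π => (min (q π i - 1) 1).toReal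
  have hp0 : ∀ i π, 0 ≤ p i π := fun i π => ENNReal.toReal_nonneg
  have hpcont : ∀ i, ContinuousOn (p i) (stdSimplex ℝ I) := by
    intro i
    refine fun π hπ => (ENNReal.continuousAt_toReal
      (min_lt_of_right_lt ENNReal.one_lt_top).ne).comp_continuousWithinAt
      (f := fun π => min (q π i - 1) 1) ?_
    have hsub : ContinuousOn (fun π => q π i - 1) (stdSimplex ℝ I) :=
      (ENNReal.continuous_sub_right 1).comp_continuousOn (hcont i)
    exact (hsub π hπ).min continuousWithinAt_const
  have hpq : ∀ i π, p i π = 0 ↔ q π i ≤ 1 := by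
    intro i π
    have hne : min (q π i - 1) 1 ≠ ∞ := (min_lt_of_right_lt ENNReal.one_lt_top).ne
    simp only [p, ENNReal.toReal_eq_zero_iff, hne, or_false]
    rw [← nonpos_iff_eq_zero, min_le_iff]
    simp [tsub_eq_zero_iff_le]
  obtain ⟨π, hπ, hπp⟩ := exists_mem_stdSimplex_forall_nonneg
    (fun i π => p i π - π i * ∑ j, p j π)
    (fun i => (hpcont i).sub ((continuous_apply i).continuousOn.mul
      (continuousOn_finsetSum _ fun j _ => hpcont j)))
    (fun π hπ => by
      by_contra! hcon
      have := Finset.sum_lt_sum_of_nonempty Finset.univ_nonempty fun i _ => hcon i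
      rw [Finset.sum_sub_distrib, ← Finset.sum_mul, hπ.2] at this
      simp at this)
    (fun π _ i hi => by simpa [hi] using hp0 i π)
  refine ⟨π, hπ, fun i => (hpq i π).1 ?_⟩
  have hsum : ∑ j, p j π = 0 := by
    by_contra hne
    have hpos : 0 < ∑ j, p j π :=
      lt_of_le_of_ne (Finset.sum_nonneg fun j _ => hp0 j π) (Ne.symm hne)
    have hgt : ∀ j, 0 < π j → 1 < q π j := by
      intro j hj
      rw [← not_le, ← hpq]
      have h1 := hπp j
      have h2 := mul_pos hj hpos
      intro h3
      simp only [h3] at h1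
      linarith
    obtain ⟨j, hj⟩ : ∃ j, 0 < π j := by
      by_contra! hcon
      have := Finset.sum_nonpos fun i (_ : i ∈ Finset.univ) => hcon i
      linarith [hπ.2]
    have hone : ∑ j, ENNReal.ofReal (π j) = 1 := by
      rw [← ENNReal.ofReal_sum_of_nonneg fun i _ => hπ.1 i, hπ.2, ENNReal.ofReal_one]
    have hlt : ∑ j, ENNReal.ofReal (π j) < expect π (q π) := by
      rw [expect, ← Finset.add_sum_erase _ _ (Finset.mem_univ j),
        ← Finset.add_sum_erase _ _ (Finset.mem_univ j)]
      refine ENNReal.add_lt_add_of_lt_of_le ?_ ?_ (Finset.sum_le_sum fun i _ => ?_)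
      · exact (ENNReal.sum_lt_top.2 fun i _ => ENNReal.ofReal_lt_top).ne
      · simpa using ENNReal.mul_lt_mul_right (ENNReal.ofReal_pos.2 hj).ne'
          ENNReal.ofReal_ne_top (hgt j hj)
      · rcases (hπ.1 i).eq_or_lt with h0 | h0
        · simp [← h0]
        · exact le_mul_of_one_le_right' (hgt i h0).le
    exact absurd (hq π hπ) (not_le.2 (hone ▸ hlt))
  exact (Finset.sum_eq_zero_iff_of_nonneg fun j _ => hp0 j π).1 hsum i (Finset.mem_univ i)

/-- Theorem 3 of the paper: if the functions `q_g` are forecast-continuous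
supermartingales then the Aggregating Algorithm is `(c,η)`-realizable. -/
theorem supermartingale_implies_aa_realizable
    {Ω : Type*} [Fintype Ω] [Nonempty Ω]
    (Λ : Set (Ω → ℝ≥0∞))
    (c η : ℝ) (hc : 1 ≤ c) (hη : 0 < η)
    (lam : (Ω → ℝ) → Ω → ℝ≥0∞)
    (hlam : ∀ π ∈ stdSimplex ℝ Ω, lam π ∈ superpred Λ)
    (hqcont : ∀ g ∈ superpred Λ, ∀ ω : Ω,
      ContinuousOn (fun π => pexp (η / c) (lam π ω) * nexp η (g ω)) (stdSimplex ℝ Ω))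
    (hqsuper : ∀ g ∈ superpred Λ, ∀ π ∈ stdSimplex ℝ Ω,
      expect π (fun ω => pexp (η / c) (lam π ω) * nexp η (g ω)) ≤ 1) :
    ∀ k : ℕ, 0 < k → ∀ (gs : Fin k → Ω → ℝ≥0∞) (ρ : Fin k → ℝ),
      (∀ i, gs i ∈ superpred Λ) → (∀ i, 0 ≤ ρ i) → (∑ i, ρ i = 1) →
      ∃ γ ∈ superpred Λ, ∀ ω : Ω,
        pexp (η / c) (γ ω) * ∑ i, ENNReal.ofReal (ρ i) * nexp η (gs i ω) ≤ 1 := by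
  intro k _ gs ρ hgs hρ hsum
  have hmix : ∀ π ω, pexp (η / c) (lam π ω) * ∑ i, ENNReal.ofReal (ρ i) * nexp η (gs i ω) =
      ∑ i, ENNReal.ofReal (ρ i) * (pexp (η / c) (lam π ω) * nexp η (gs i ω)) := by
    intro π ω
    rw [Finset.mul_sum]
    exact Finset.sum_congr rfl fun i _ => mul_left_comm _ _ _
  obtain ⟨π, hπ, hle⟩ := exists_forall_le_one_of_expect_le_one
    (fun π ω => pexp (η / c) (lam π ω) * ∑ i, ENNReal.ofReal (ρ i) * nexp η (gs i ω))
    (fun ω => by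
      simp only [hmix]
      exact continuousOn_finsetSum _ fun i _ =>
        (ENNReal.continuous_const_mul ENNReal.ofReal_ne_top).comp_continuousOn
          (hqcont (gs i) (hgs i) ω))
    (fun π hπ => by
      have hexp : expect π (fun ω =>
          pexp (η / c) (lam π ω) * ∑ i, ENNReal.ofReal (ρ i) * nexp η (gs i ω)) =
          ∑ i, ENNReal.ofReal (ρ i) *
            expect π (fun ω => pexp (η / c) (lam π ω) * nexp η (gs i ω)) := by
        simp only [expect, hmix, Finset.mul_sum]
        rw [Finset.sum_comm]
        exact Finset.sum_congr rfl fun i _ => Finset.sum_congr rfl fun ω _ =>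
          mul_left_comm _ _ _
      rw [hexp]
      calc _ ≤ ∑ i, ENNReal.ofReal (ρ i) * 1 :=
            Finset.sum_le_sum fun i _ => by gcongr; exact hqsuper (gs i) (hgs i) π hπ
        _ = 1 := by
            simp only [mul_one]
            rw [← ENNReal.ofReal_sum_of_nonneg fun i _ => hρ i, hsum, ENNReal.ofReal_one])
  exact ⟨lam π, hlam π hπ, hle⟩
end
end
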